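/- Let U be a bounded open subset of ℝⁿ and f : ℝˡ × ℝⁿ → ℝᵐ an infinitely differentiable function (jointly in (t,x)) such that for every t ∈ ℝˡ the function f(t,·) has compact support contained in U. Then for every natural number k, the map Φ_k : t ↦ (x ↦ D_x^k f(t,x)), from ℝˡ into the Banach space of bounded continuous functions from ℝⁿ to the continuous k-multilinear maps with the sup norm, is well-defined and infinitely differentiable; moreover, for every multi-index α in t, its α-th Fréchet derivative satisfies (∂_t^α Φ_k)(t) = (x ↦ D_x^k (∂_t^α f)(t,x)). -/

import Mathlib

/-- The partial derivative in the `i`-th coordinate direction of `ℝᴺ`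
(as a Fréchet derivative applied to the `i`-th basis vector). -/
noncomputable def pderivCoord {N : ℕ} {F : Type*} [NormedAddCommGroup F] [NormedSpace ℝ F]
    (i : Fin N) (g : EuclideanSpace ℝ (Fin N) → F) : EuclideanSpace ℝ (Fin N) → F :=
  fun s => fderiv ℝ g s (EuclideanSpace.single i 1)

/-- Iterated partial derivative `∂^{α₁}_{x₁} ⋯ ∂^{α_N}_{x_N}` for a multi-index `α`. -/
noncomputable def pderivMulti {N : ℕ} {F : Type*} [NormedAddCommGroup F] [NormedSpace ℝ F]
    (α : Fin N → ℕ) (g : EuclideanSpace ℝ (Fin N) → F) : EuclideanSpace ℝ (Fin N) → F :=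
  (List.finRange N).foldr (fun i h => (pderivCoord i)^[α i] h) g

open scoped BoundedContinuousFunction ContDiff
open Filter Topology

section BoundedContinuousFamily

variable {T X G : Type*} [NormedAddCommGroup T] [NormedSpace ℝ T] [TopologicalSpace X]
  [NormedAddCommGroup G] [NormedSpace ℝ G]

/-- Pointwise evaluation of a bounded family of continuous linear maps, as a continuous linear map
into the space of bounded continuous functions. -/
noncomputable def boundedFamilyEval :
    (X →ᵇ (T →L[ℝ] G)) →L[ℝ] (T →L[ℝ] (X →ᵇ G)) :=
  LinearMap.mkContinuous₂
    (LinearMap.mk₂ ℝ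
      (fun (ψ : X →ᵇ (T →L[ℝ] G)) (v : T) =>
        (ContinuousLinearMap.apply ℝ G v).compLeftContinuousBounded X ψ)
      (fun ψ₁ ψ₂ v => by ext x; simp)
      (fun c ψ v => by ext x; simp)
      (fun ψ v₁ v₂ => by ext x; simp)
      (fun c ψ v => by ext x; simp)) 1
    (fun ψ v => by
      refine (BoundedContinuousFunction.norm_le (by positivity)).2 fun x => ?_
      rw [one_mul]
      exact ((ψ x).le_opNorm v).trans (by gcongr; exact ψ.norm_coe_le_norm x))

@[simp]
theorem boundedFamilyEval_apply (ψ : X →ᵇ (T →L[ℝ] G)) (v : T) (x : X) :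
    boundedFamilyEval ψ v x = ψ x v := rfl

/-- A family of bounded continuous functions is differentiable for the sup norm if it is
pointwise differentiable and the pointwise derivatives depend continuously on the parameter for
the sup norm. -/
theorem hasFDerivAt_boundedContinuousFunction {Φ : T → X →ᵇ G} {Ψ : T → X →ᵇ (T →L[ℝ] G)}
    {t : T} (hΨ : ContinuousAt Ψ t) (h : ∀ s x, HasFDerivAt (fun s => Φ s x) (Ψ s x) s) :
    HasFDerivAt Φ (boundedFamilyEval (Ψ t)) t := by
  rw [hasFDerivAt_iff_isLittleO, Asymptotics.isLittleO_iff]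
  intro c hc
  obtain ⟨δ, hδ, hball⟩ := Metric.continuousAt_iff.1 hΨ c hc
  filter_upwards [Metric.ball_mem_nhds t hδ] with s hs
  refine (BoundedContinuousFunction.norm_le (by positivity)).2 fun x => ?_
  refine (convex_ball t δ).norm_image_sub_le_of_norm_hasFDerivWithin_le'
    (f := fun s => Φ s x) (f' := fun s => Ψ s x) (φ := Ψ t x) (C := c)
    (fun r _ => (h r x).hasFDerivWithinAt) (fun r hr => ?_) (Metric.mem_ball_self hδ) hs
  rw [← dist_eq_norm]
  exact (BoundedContinuousFunction.dist_coe_le_dist x).trans (hball hr).le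

/-- A jointly continuous family of functions supported in a fixed compact set is continuous for
the sup norm. -/
theorem continuous_boundedContinuousFunction_of_uncurry {T X G : Type*} [TopologicalSpace T]
    [TopologicalSpace X] [NormedAddCommGroup G] {K : Set X} (hK : IsCompact K) {Φ : T → X →ᵇ G}
    (hc : Continuous fun p : T × X => Φ p.1 p.2) (h0 : ∀ t, ∀ x ∉ K, Φ t x = 0) :
    Continuous Φ := by
  rw [continuous_iff_continuousAt]
  intro t
  rw [ContinuousAt, Metric.tendsto_nhds]
  intro ε hε
  have hev : ∀ᶠ s in 𝓝 t, ∀ x ∈ K, dist (Φ s x) (Φ t x) < ε / 2 := by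
    refine hK.eventually_forall_of_forall_eventually fun x _ => ?_
    have : Continuous fun p : T × X => dist (Φ p.1 p.2) (Φ t p.2) :=
      hc.dist ((Φ t).continuous.comp continuous_snd)
    exact this.continuousAt.eventually_lt continuousAt_const (by simpa using half_pos hε)
  filter_upwards [hev] with s hs
  refine lt_of_le_of_lt ((BoundedContinuousFunction.dist_le (half_pos hε).le).2 fun x => ?_)
    (half_lt_self hε)
  by_cases hx : x ∈ K
  · exact (hs x hx).le
  · rw [h0 s x hx, h0 t x hx, dist_self]
    exact (half_pos hε).le

/-- A continuous function vanishing outside a compact set is bounded. -/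
theorem exists_boundedContinuousFunction_eq {X G : Type*} [TopologicalSpace X]
    [NormedAddCommGroup G] {K : Set X} (hK : IsCompact K) {g : X → G} (hg : Continuous g)
    (h0 : ∀ x ∉ K, g x = 0) : ∃ φ : X →ᵇ G, ∀ x, φ x = g x := by
  obtain ⟨C, hC⟩ := hK.exists_bound_of_continuousOn hg.continuousOn
  refine ⟨BoundedContinuousFunction.ofNormedAddCommGroup g hg (max C 0) fun x => ?_, fun x => rfl⟩
  by_cases hx : x ∈ K
  · exact (hC x hx).trans (le_max_left _ _)
  · simp [h0 x hx]

end BoundedContinuousFamily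

section SmoothFamily

variable {T X : Type*} [NormedAddCommGroup T] [NormedSpace ℝ T] [NormedAddCommGroup X]
  [NormedSpace ℝ X]

theorem hasFDerivAt_partial_left {G : Type*} [NormedAddCommGroup G] [NormedSpace ℝ G]
    {g : T × X → G} {t : T} {x : X} (hg : DifferentiableAt ℝ g (t, x)) :
    HasFDerivAt (fun s => g (s, x)) ((fderiv ℝ g (t, x)).comp (.inl ℝ T X)) t :=
  hg.hasFDerivAt.comp t (hasFDerivAt_prodMk_left t x)

theorem contDiff_partial_left {G : Type*} [NormedAddCommGroup G] [NormedSpace ℝ G]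
    {g : T × X → G} (hg : ContDiff ℝ ∞ g) :
    ContDiff ℝ ∞ fun p : T × X => fderiv ℝ (fun s => g (s, p.2)) p.1 := by
  have : (fun p : T × X => fderiv ℝ (fun s => g (s, p.2)) p.1) =
      fun p => (fderiv ℝ g p).comp (.inl ℝ T X) :=
    funext fun p => (hasFDerivAt_partial_left (hg.differentiable (by simp) _)).fderiv
  rw [this]
  exact (hg.fderiv_right (by simp)).clm_comp contDiff_const

/-- A jointly smooth family supported in a fixed compact set has a sup-norm derivative. -/
theorem exists_hasFDerivAt_of_contDiff {G : Type*} [NormedAddCommGroup G] [NormedSpace ℝ G]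
    {K : Set X} (hK : IsCompact K) {Φ : T → X →ᵇ G}
    (hΦ : ContDiff ℝ ∞ fun p : T × X => Φ p.1 p.2) (h0 : ∀ t, ∀ x ∉ K, Φ t x = 0) :
    ∃ Ψ : T → X →ᵇ (T →L[ℝ] G), (ContDiff ℝ ∞ fun p : T × X => Ψ p.1 p.2) ∧
      (∀ t, ∀ x ∉ K, Ψ t x = 0) ∧ (∀ t x, Ψ t x = fderiv ℝ (fun s => Φ s x) t) ∧
      ∀ t, HasFDerivAt Φ (boundedFamilyEval (Ψ t)) t := by
  have hsm := contDiff_partial_left hΦ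
  have hz : ∀ t, ∀ x ∉ K, fderiv ℝ (fun s => Φ s x) t = 0 := fun t x hx => by
    simp [h0 _ x hx]
  choose Ψ hΨ using fun t => exists_boundedContinuousFunction_eq hK
    (g := fun x => fderiv ℝ (fun s => Φ s x) t)
    (hsm.continuous.comp (Continuous.prodMk_right t)) (hz t)
  have hΨsm : ContDiff ℝ ∞ fun p : T × X => Ψ p.1 p.2 := by simpa only [hΨ] using hsm
  have hΨ0 : ∀ t, ∀ x ∉ K, Ψ t x = 0 := fun t x hx => by rw [hΨ, hz t x hx]
  refine ⟨Ψ, hΨsm, hΨ0, hΨ, fun t => hasFDerivAt_boundedContinuousFunction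
    (continuous_boundedContinuousFunction_of_uncurry hK hΨsm.continuous hΨ0).continuousAt
    fun s x => ?_⟩
  rw [hΨ]
  exact (hasFDerivAt_partial_left (g := fun p : T × X => Φ p.1 p.2)
    (hΦ.differentiable (by simp) _)).differentiableAt.hasFDerivAt

theorem fderiv_boundedContinuousFunction_apply {G : Type*} [NormedAddCommGroup G]
    [NormedSpace ℝ G] {K : Set X} (hK : IsCompact K) {Φ : T → X →ᵇ G}
    (hΦ : ContDiff ℝ ∞ fun p : T × X => Φ p.1 p.2) (h0 : ∀ t, ∀ x ∉ K, Φ t x = 0)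
    (t v : T) (x : X) : fderiv ℝ Φ t v x = fderiv ℝ (fun s => Φ s x) t v := by
  obtain ⟨Ψ, -, -, hΨ, hd⟩ := exists_hasFDerivAt_of_contDiff hK hΦ h0
  rw [(hd t).fderiv, boundedFamilyEval_apply, hΨ]

end SmoothFamily

universe u v w

/-- A jointly smooth family supported in a fixed compact set is smooth for the sup norm. -/
theorem contDiff_boundedContinuousFunction {T : Type u} {X : Type v} {G : Type max u w}
    [NormedAddCommGroup T] [NormedSpace ℝ T]
    [NormedAddCommGroup X] [NormedSpace ℝ X] [NormedAddCommGroup G] [NormedSpace ℝ G]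
    {K : Set X} (hK : IsCompact K) {Φ : T → X →ᵇ G}
    (hΦ : ContDiff ℝ ∞ fun p : T × X => Φ p.1 p.2) (h0 : ∀ t, ∀ x ∉ K, Φ t x = 0) :
    ContDiff ℝ ∞ Φ := by
  rw [contDiff_infty]
  intro N
  induction N generalizing G with
  | zero =>
    exact contDiff_zero.2 (continuous_boundedContinuousFunction_of_uncurry hK hΦ.continuous h0)
  | succ N ih =>
    obtain ⟨Ψ, hΨ, hΨ0, -, hd⟩ := exists_hasFDerivAt_of_contDiff hK hΦ h0
    push_cast
    rw [contDiff_succ_iff_hasFDerivAt]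
    have hL : ContDiff ℝ N (boundedFamilyEval (T := T) (X := X) (G := G)) := by
      fun_prop
    exact ⟨fun t => boundedFamilyEval (Ψ t), hL.comp (ih hΨ hΨ0), hd⟩

section IteratedDerivatives

/-- Directional derivatives commute with iterated derivatives. -/
theorem fderiv_iteratedFDeriv_apply_eq {E G : Type*} [NormedAddCommGroup E] [NormedSpace ℝ E]
    [NormedAddCommGroup G] [NormedSpace ℝ G] {F : E → G} (hF : ContDiff ℝ ∞ F) (k : ℕ) (p v : E) :
    fderiv ℝ (iteratedFDeriv ℝ k F) p v = iteratedFDeriv ℝ k (fun q => fderiv ℝ F q v) p := by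
  induction k generalizing p with
  | zero =>
    ext m
    rw [iteratedFDeriv_zero_eq_comp, iteratedFDeriv_zero_apply,
      LinearIsometryEquiv.comp_fderiv]
    simp
  | succ k ih =>
    ext m
    have hk : ContDiff ℝ ∞ (iteratedFDeriv ℝ k F) := hF.iteratedFDeriv_right (mod_cast le_top)
    have hk' : Differentiable ℝ (fderiv ℝ (iteratedFDeriv ℝ k F)) :=
      (hk.fderiv_right (m := ∞) (by simp)).differentiable (by simp)
    have hk1 : Differentiable ℝ (iteratedFDeriv ℝ (k + 1) F) :=
      (hF.iteratedFDeriv_right (m := ∞) (mod_cast le_top)).differentiable (by simp)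
    have hsymm : IsSymmSndFDerivAt ℝ (iteratedFDeriv ℝ k F) p :=
      hk.contDiffAt.isSymmSndFDerivAt (by
        rw [minSmoothness_of_isRCLikeNormedField]; exact WithTop.coe_le_coe.2 le_top)
    rw [iteratedFDeriv_succ_apply_left, ← funext ih,
      fderiv_clm_apply hk'.differentiableAt (by fun_prop)]
    have h1 : fderiv ℝ (iteratedFDeriv ℝ (k + 1) F) p v m =
        fderiv ℝ (fun q => iteratedFDeriv ℝ (k + 1) F q m) p v := by
      rw [fderiv_continuousMultilinear_apply_const_apply hk1.differentiableAt]
    rw [h1]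
    simp only [iteratedFDeriv_succ_apply_left]
    rw [fderiv_continuousMultilinear_apply_const_apply (by fun_prop),
      fderiv_clm_apply hk'.differentiableAt (by fun_prop)]
    simp [hsymm.eq v (m 0)]

variable {T X G : Type*} [NormedAddCommGroup T] [NormedSpace ℝ T] [NormedAddCommGroup X]
  [NormedSpace ℝ X] [NormedAddCommGroup G] [NormedSpace ℝ G]

theorem iteratedFDeriv_partial_right {F : T × X → G} (hF : ContDiff ℝ ∞ F) (k : ℕ) (t : T)
    (x : X) : iteratedFDeriv ℝ k (fun y => F (t, y)) x =
      (iteratedFDeriv ℝ k F (t, x)).compContinuousLinearMap fun _ => .inr ℝ T X := by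
  have h : (fun y => F (t, y)) = (fun q => F ((t, 0) + q)) ∘ ContinuousLinearMap.inr ℝ T X := by
    ext y; simp
  rw [h, ContinuousLinearMap.iteratedFDeriv_comp_right (n := ∞) _ (by fun_prop) _
    (by exact_mod_cast le_top), iteratedFDeriv_comp_add_left]
  simp

theorem contDiff_iteratedFDeriv_partial_right {F : T × X → G} (hF : ContDiff ℝ ∞ F) (k : ℕ) :
    ContDiff ℝ ∞ fun p : T × X => iteratedFDeriv ℝ k (fun y => F (p.1, y)) p.2 := by
  simp only [iteratedFDeriv_partial_right hF]
  exact (ContinuousMultilinearMap.compContinuousLinearMapL (F := G)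
    fun _ : Fin k => ContinuousLinearMap.inr ℝ T X).contDiff.comp
      (hF.iteratedFDeriv_right (m := ∞) (mod_cast le_top))

theorem fderiv_iteratedFDeriv_partial {F : T × X → G} (hF : ContDiff ℝ ∞ F) (k : ℕ) (t v : T)
    (x : X) : fderiv ℝ (fun s => iteratedFDeriv ℝ k (fun y => F (s, y)) x) t v =
      iteratedFDeriv ℝ k (fun y => fderiv ℝ (fun s => F (s, y)) t v) x := by
  have hk : Differentiable ℝ (iteratedFDeriv ℝ k F) :=
    (hF.iteratedFDeriv_right (m := ∞) (mod_cast le_top)).differentiable (by simp)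
  have hd : ∀ y, fderiv ℝ (fun s => F (s, y)) t v = fderiv ℝ F (t, y) (v, 0) := fun y => by
    rw [(hasFDerivAt_partial_left (hF.differentiable (by simp) _)).fderiv]; simp
  have hv : ContDiff ℝ ∞ fun q => fderiv ℝ F q (v, 0) :=
    (hF.fderiv_right (by simp)).clm_apply contDiff_const
  simp only [hd]
  rw [iteratedFDeriv_partial_right hv, ← fderiv_iteratedFDeriv_apply_eq hF]
  simp only [iteratedFDeriv_partial_right hF]
  have := (ContinuousMultilinearMap.compContinuousLinearMapL (F := G)
    fun _ : Fin k => ContinuousLinearMap.inr ℝ T X).hasFDerivAt.comp t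
      (hasFDerivAt_partial_left (hk (t, x)))
  exact congrArg (· v) this.fderiv

theorem iteratedFDeriv_eq_zero_of_notMem {K : Set X} (hK : IsClosed K) {g : X → G}
    (h0 : ∀ x ∉ K, g x = 0) (k : ℕ) {x : X} (hx : x ∉ K) : iteratedFDeriv ℝ k g x = 0 := by
  have hsupp : tsupport g ⊆ K :=
    closure_minimal (fun y hy => by_contra fun hyK => hy (h0 y hyK)) hK
  exact Function.notMem_support.1 fun h => hx (hsupp (support_iteratedFDeriv_subset k h))

end IteratedDerivatives

/-- `Φ` is the sup-norm family of `k`-th derivatives of the jointly smooth family `f`, whose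
members are all supported in `K`. -/
structure IsDerivFamily {T X G : Type*} [NormedAddCommGroup T] [NormedSpace ℝ T]
    [NormedAddCommGroup X] [NormedSpace ℝ X] [NormedAddCommGroup G] [NormedSpace ℝ G]
    (K : Set X) (k : ℕ) (f : T → X → G) (Φ : T → X →ᵇ (X [×k]→L[ℝ] G)) : Prop where
  contDiff : ContDiff ℝ ∞ fun p : T × X => f p.1 p.2
  eq_zero : ∀ t, ∀ x ∉ K, f t x = 0
  apply_eq : ∀ t x, Φ t x = iteratedFDeriv ℝ k (f t) x

namespace IsDerivFamily

section

variable {T X G : Type*} [NormedAddCommGroup T] [NormedSpace ℝ T]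
  [NormedAddCommGroup X] [NormedSpace ℝ X] [NormedAddCommGroup G] [NormedSpace ℝ G]
  {K : Set X} {k : ℕ} {f : T → X → G} {Φ : T → X →ᵇ (X [×k]→L[ℝ] G)}

theorem contDiff_uncurry (h : IsDerivFamily K k f Φ) :
    ContDiff ℝ ∞ fun p : T × X => Φ p.1 p.2 := by
  simp only [h.apply_eq]
  exact contDiff_iteratedFDeriv_partial_right h.contDiff k

theorem apply_eq_zero (h : IsDerivFamily K k f Φ) (hK : IsClosed K) (t : T) (x : X)
    (hx : x ∉ K) : Φ t x = 0 := by
  rw [h.apply_eq]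
  exact iteratedFDeriv_eq_zero_of_notMem hK (h.eq_zero t) k hx

theorem fderiv_apply (h : IsDerivFamily K k f Φ) (hK : IsCompact K) (v : T) :
    IsDerivFamily K k (fun t x => fderiv ℝ (fun s => f s x) t v) (fun t => fderiv ℝ Φ t v) where
  contDiff := (contDiff_partial_left h.contDiff).clm_apply contDiff_const
  eq_zero t x hx := by simp [h.eq_zero _ x hx]
  apply_eq t x := by
    rw [fderiv_boundedContinuousFunction_apply hK h.contDiff_uncurry
      (h.apply_eq_zero hK.isClosed)]
    simp only [h.apply_eq]
    exact fderiv_iteratedFDeriv_partial h.contDiff k t v x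

end

variable {N : ℕ} {X G : Type*} [NormedAddCommGroup X] [NormedSpace ℝ X] [NormedAddCommGroup G]
  [NormedSpace ℝ G] {K : Set X} {k : ℕ} {f : EuclideanSpace ℝ (Fin N) → X → G}
  {Φ : EuclideanSpace ℝ (Fin N) → X →ᵇ (X [×k]→L[ℝ] G)}

theorem pderivCoord_iterate (h : IsDerivFamily K k f Φ) (hK : IsCompact K) (i : Fin N) (a : ℕ) :
    IsDerivFamily K k (fun t x => (pderivCoord i)^[a] (fun s => f s x) t)
      ((pderivCoord i)^[a] Φ) := by
  induction a with
  | zero => exact h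
  | succ a ih =>
    simp only [Function.iterate_succ_apply']
    exact ih.fderiv_apply hK _

theorem pderivMulti (h : IsDerivFamily K k f Φ) (hK : IsCompact K) (α : Fin N → ℕ) :
    IsDerivFamily K k (fun t x => _root_.pderivMulti α (fun s => f s x) t)
      (_root_.pderivMulti α Φ) := by
  unfold _root_.pderivMulti
  induction List.finRange N with
  | nil => exact h
  | cons i L ih => exact ih.pderivCoord_iterate hK i (α i)

end IsDerivFamily

/-- Let `U ⊆ ℝⁿ` be bounded and open, and let
`f : ℝˡ × ℝⁿ → ℝᵐ` be jointly smooth, with `f t` compactly supported in `U`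
for every `t`.  Then for every `k : ℕ` the map `Φₖ : t ↦ (x ↦ D_x^k f(t,x))`
into the Banach space of bounded continuous functions from `ℝⁿ` to the
continuous `k`-multilinear maps (sup norm) is well defined and smooth, and
moreover for every multi-index `α` in `t`,
`(∂_t^α Φₖ)(t) = (x ↦ D_x^k (∂_t^α f)(t, x))`. -/
theorem smooth_into_Ck_of_smooth (l n m : ℕ)
    (U : Set (EuclideanSpace ℝ (Fin n))) (hUopen : IsOpen U)
    (hUbdd : Bornology.IsBounded U)
    (f : EuclideanSpace ℝ (Fin l) → EuclideanSpace ℝ (Fin n) → EuclideanSpace ℝ (Fin m))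
    (hf : ContDiff ℝ (⊤ : ℕ∞) (Function.uncurry f))
    (hsupp : ∀ t, HasCompactSupport (f t) ∧ tsupport (f t) ⊆ U) :
    ∀ k : ℕ, ∃ Φ : EuclideanSpace ℝ (Fin l) →
        BoundedContinuousFunction (EuclideanSpace ℝ (Fin n))
          (ContinuousMultilinearMap ℝ (fun _ : Fin k => EuclideanSpace ℝ (Fin n))
            (EuclideanSpace ℝ (Fin m))),
      (∀ t x, Φ t x = iteratedFDeriv ℝ k (f t) x) ∧
      ContDiff ℝ (⊤ : ℕ∞) Φ ∧
      (∀ (α : Fin l → ℕ) (t : EuclideanSpace ℝ (Fin l)) (x : EuclideanSpace ℝ (Fin n)),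
        pderivMulti α Φ t x =
          iteratedFDeriv ℝ k (fun x' => pderivMulti α (fun t' => f t' x') t) x) := by
  intro k
  have hK : IsCompact (closure U) := hUbdd.isCompact_closure
  have h0 : ∀ t, ∀ x ∉ closure U, f t x = 0 := fun t x hx =>
    image_eq_zero_of_notMem_tsupport fun h => hx (subset_closure ((hsupp t).2 h))
  have hf' : ContDiff ℝ ∞ fun p : EuclideanSpace ℝ (Fin l) × EuclideanSpace ℝ (Fin n) =>
      f p.1 p.2 := hf
  choose Φ hΦ using fun t => exists_boundedContinuousFunction_eq hK
    (g := iteratedFDeriv ℝ k (f t))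
    ((contDiff_iteratedFDeriv_partial_right hf' k).continuous.comp (Continuous.prodMk_right t))
    (fun x hx => iteratedFDeriv_eq_zero_of_notMem isClosed_closure (h0 t) k hx)
  have hfam : IsDerivFamily (closure U) k f Φ := ⟨hf', h0, hΦ⟩
  exact ⟨Φ, hΦ, contDiff_boundedContinuousFunction hK hfam.contDiff_uncurry
    (hfam.apply_eq_zero isClosed_closure), fun α t x => (hfam.pderivMulti hK α).apply_eq t x⟩
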